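/- There exists exactly one stationary Borel probability measure m_{τ,ε} on the circle ℝ/ℤ for the noisy Arnol'd circle map family: a Borel probability measure m satisfying ∫_I (F_w)_* m dν(w) = m exists, and any two Borel probability measures satisfying this identity are equal. -/

import Mathlib

open MeasureTheory Real Filter Set Function

noncomputable section

lemma sin2_periodic : Function.Periodic (fun x : ℝ => Real.sin (2 * π * x)) 1 := by
  intro x
  simp only [mul_add, mul_one]
  exact Real.sin_add_two_pi _

/-- `sin (2πx)` viewed as a function on the circle `ℝ/ℤ`. -/
def sinA : AddCircle (1:ℝ) → ℝ := sin2_periodic.lift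

/-- The noisy Arnol'd circle map `F_w(x) = x + τ + σ w − ε sin (2πx)  (mod 1)`. -/
def Fmap (τ ε σ w : ℝ) : AddCircle (1:ℝ) → AddCircle (1:ℝ) :=
  fun x => x + (↑(τ + σ * w - ε * sinA x) : AddCircle (1:ℝ))

/-- The uniform probability measure on `I = [−1/2, 1/2]`. -/
def nuI : Measure ℝ := volume.restrict (Icc (-(1/2) : ℝ) (1/2))

/-- A Borel probability measure `m` on the circle is stationary for the noisy circle-map
family when `∫_I (F_w)_* m dν(w) = m`. -/
def IsStationaryMeasure (τ ε σ : ℝ) (m : Measure (AddCircle (1:ℝ))) : Prop :=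
  nuI.bind (fun w => m.map (Fmap τ ε σ w)) = m

open scoped Topology

/-- The identity behind the Schwarz–Pick lemma. -/
lemma one_sub_norm_sq_mul (a s : ℂ) :
    (1 - ‖a‖ ^ 2) * (1 - ‖s‖ ^ 2) =
      ‖1 - (starRingEnd ℂ) a * s‖ ^ 2 - ‖s - a‖ ^ 2 := by
  simp only [← Complex.normSq_eq_norm_sq, Complex.normSq_apply, Complex.sub_re, Complex.sub_im,
    Complex.mul_re, Complex.mul_im, Complex.conj_re, Complex.conj_im, Complex.one_re,
    Complex.one_im]
  ring

lemma one_sub_conj_mul_ne_zero {a s : ℂ} (ha : ‖a‖ < 1) (hs : ‖s‖ < 1) :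
    1 - (starRingEnd ℂ) a * s ≠ 0 := by
  intro h
  have h1 : (1 : ℂ) = (starRingEnd ℂ) a * s := sub_eq_zero.mp h
  have h2 : (1 : ℝ) = ‖a‖ * ‖s‖ := by
    have := congrArg norm h1
    simpa using this
  nlinarith [norm_nonneg a, norm_nonneg s]

/-- The automorphism of the unit disc sending `a` to `0`. -/
def discAut (a s : ℂ) : ℂ := (s - a) / (1 - (starRingEnd ℂ) a * s)

lemma one_sub_norm_discAut_sq {a s : ℂ} (ha : ‖a‖ < 1) (hs : ‖s‖ < 1) :
    1 - ‖s‖ ^ 2 =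
      ‖1 - (starRingEnd ℂ) a * s‖ ^ 2 * (1 - ‖discAut a s‖ ^ 2) / (1 - ‖a‖ ^ 2) := by
  have h0 : ‖1 - (starRingEnd ℂ) a * s‖ ≠ 0 := norm_ne_zero_iff.mpr (one_sub_conj_mul_ne_zero ha hs)
  have h1 : 1 - ‖a‖ ^ 2 ≠ 0 := by nlinarith [norm_nonneg a]
  have := one_sub_norm_sq_mul a s
  rw [discAut, norm_div]
  field_simp
  linarith

lemma hasDerivAt_discAut_comp {f : ℂ → ℂ} {f' z : ℂ} (hf : HasDerivAt f f' z) (h1 : ‖f z‖ < 1) :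
    HasDerivAt (fun x => discAut (f z) (f x)) (f' / (1 - ‖f z‖ ^ 2 : ℝ)) z := by
  have hne := one_sub_conj_mul_ne_zero h1 h1
  have h := (hf.sub_const (f z)).div ((hf.const_mul ((starRingEnd ℂ) (f z))).const_sub 1) hne
  unfold discAut
  refine h.congr_deriv ?_
  have hc : (starRingEnd ℂ) (f z) * f z = ((‖f z‖ ^ 2 : ℝ) : ℂ) := by
    rw [mul_comm, Complex.mul_conj, Complex.normSq_eq_norm_sq]
  rw [hc] at hne ⊢
  have : ((1 - ‖f z‖ ^ 2 : ℝ) : ℂ) ≠ 0 := by simpa using hne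
  push_cast at *
  field_simp
  simp

/-- The ratio between the pullbacks of the hyperbolic metric of the unit disc by `ψ` and by `S`. -/
def metricRatio (S ψ : ℂ → ℂ) (z : ℂ) : ℝ :=
  ‖deriv ψ z‖ * (1 - ‖S z‖ ^ 2) / (‖deriv S z‖ * (1 - ‖ψ z‖ ^ 2))

/-- Local form of the Schwarz–Pick–Ahlfors lemma: a local maximum of the ratio is at most one. -/
lemma metricRatio_le_one_of_isLocalMax {S ψ : ℂ → ℂ} {z₀ : ℂ} (hS : AnalyticAt ℂ S z₀)
    (hψ : AnalyticAt ℂ ψ z₀) (hS1 : ‖S z₀‖ < 1) (hψ1 : ‖ψ z₀‖ < 1) (hS' : deriv S z₀ ≠ 0)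
    (hmax : IsLocalMax (metricRatio S ψ) z₀) : metricRatio S ψ z₀ ≤ 1 := by
  by_contra! hgt
  set A : ℂ → ℂ := fun z => discAut (S z₀) (S z) with hA
  set B : ℂ → ℂ := fun z => discAut (ψ z₀) (ψ z) with hB
  set H : ℂ → ℂ := fun z => deriv ψ z / deriv S z *
    ((1 - (starRingEnd ℂ) (S z₀) * S z) / (1 - (starRingEnd ℂ) (ψ z₀) * ψ z)) ^ 2 with hH
  have hpS : 0 < 1 - ‖S z₀‖ ^ 2 := by nlinarith [norm_nonneg (S z₀)]
  have hpψ : 0 < 1 - ‖ψ z₀‖ ^ 2 := by nlinarith [norm_nonneg (ψ z₀)]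
  set K : ℝ := (1 - ‖ψ z₀‖ ^ 2) / (1 - ‖S z₀‖ ^ 2) with hK
  have hKpos : 0 < K := div_pos hpψ hpS
  have hA0 : A z₀ = 0 := by simp [hA, discAut]
  have hB0 : B z₀ = 0 := by simp [hB, discAut]
  have dA := hasDerivAt_discAut_comp hS.differentiableAt.hasDerivAt hS1
  have dB := hasDerivAt_discAut_comp hψ.differentiableAt.hasDerivAt hψ1
  have hlt : ‖deriv S z₀ / (1 - ‖S z₀‖ ^ 2 : ℝ)‖ < ‖deriv ψ z₀ / (1 - ‖ψ z₀‖ ^ 2 : ℝ)‖ := by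
    have hS'n : 0 < ‖deriv S z₀‖ := norm_pos_iff.mpr hS'
    rw [norm_div, norm_div, Complex.norm_of_nonneg hpS.le, Complex.norm_of_nonneg hpψ.le,
      div_lt_div_iff₀ hpS hpψ]
    rw [metricRatio, one_lt_div (mul_pos hS'n hpψ)] at hgt
    exact hgt
  have hAB : ∀ᶠ z in 𝓝[≠] z₀, ‖A z‖ < ‖B z‖ := by
    have tA := (hasDerivAt_iff_tendsto_slope.mp dA).norm
    have tB := (hasDerivAt_iff_tendsto_slope.mp dB).norm
    filter_upwards [tA.eventually_lt tB hlt, self_mem_nhdsWithin] with z hz hne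
    have hne' : z - z₀ ≠ 0 := sub_ne_zero.mpr hne
    have e1 : slope (fun x => discAut (S z₀) (S x)) z₀ z = (z - z₀)⁻¹ * A z := by
      simp [slope_def_module, hA, discAut]
    have e2 : slope (fun x => discAut (ψ z₀) (ψ x)) z₀ z = (z - z₀)⁻¹ * B z := by
      simp [slope_def_module, hB, discAut]
    rw [e1, e2, norm_mul, norm_mul] at hz
    exact lt_of_mul_lt_mul_left hz (norm_nonneg _)
  have hS1' : ∀ᶠ z in 𝓝 z₀, ‖S z‖ < 1 := hS.continuousAt.norm.eventually_lt_const hS1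
  have hψ1' : ∀ᶠ z in 𝓝 z₀, ‖ψ z‖ < 1 := hψ.continuousAt.norm.eventually_lt_const hψ1
  have key : ∀ z, ‖S z‖ < 1 → ‖ψ z‖ < 1 →
      metricRatio S ψ z = ‖H z‖ * K * ((1 - ‖A z‖ ^ 2) / (1 - ‖B z‖ ^ 2)) := by
    intro z h1 h2
    have n2 : ‖1 - (starRingEnd ℂ) (ψ z₀) * ψ z‖ ≠ 0 :=
      norm_ne_zero_iff.mpr (one_sub_conj_mul_ne_zero hψ1 h2)
    rw [metricRatio, one_sub_norm_discAut_sq hS1 h1, one_sub_norm_discAut_sq hψ1 h2]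
    simp only [hH, hK, hA, hB, norm_mul, norm_div, norm_pow]
    simp only [div_eq_mul_inv, mul_inv, inv_inv, mul_pow, inv_pow]
    ring
  have hv0 : metricRatio S ψ z₀ = ‖H z₀‖ * K := by
    rw [key z₀ hS1 hψ1, hA0, hB0]; simp
  have hH0 : 0 < ‖H z₀‖ := by
    rw [hv0] at hgt
    by_contra! hc
    nlinarith
  have hBlt : ∀ᶠ z in 𝓝 z₀, ‖B z‖ < 1 := by
    have : ContinuousAt B z₀ := dB.continuousAt
    refine this.norm.eventually_lt_const ?_
    simp [hB0]
  have hstep : ∀ᶠ z in 𝓝[≠] z₀, ‖H z‖ ≤ ‖H z₀‖ ∧ H z ≠ H z₀ := by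
    filter_upwards [hAB, nhdsWithin_le_nhds hS1', nhdsWithin_le_nhds hψ1',
      nhdsWithin_le_nhds hBlt, nhdsWithin_le_nhds hmax] with z h1 h2 h3 h4 h5
    have h5' : metricRatio S ψ z ≤ metricRatio S ψ z₀ := h5
    rw [hv0, key z h2 h3] at h5'
    have hb : 0 < 1 - ‖B z‖ ^ 2 := by nlinarith [norm_nonneg (B z)]
    have hr : 1 < (1 - ‖A z‖ ^ 2) / (1 - ‖B z‖ ^ 2) := by
      rw [one_lt_div hb]; nlinarith [norm_nonneg (A z)]
    have h6 : ‖H z‖ * ((1 - ‖A z‖ ^ 2) / (1 - ‖B z‖ ^ 2)) ≤ ‖H z₀‖ := by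
      refine le_of_mul_le_mul_right ?_ hKpos
      linarith
    constructor
    · nlinarith [norm_nonneg (H z)]
    · intro he
      rw [he] at h6
      nlinarith
  have hHan : AnalyticAt ℂ H z₀ := by
    refine (hψ.deriv.div hS.deriv hS').mul (AnalyticAt.pow ?_ 2)
    exact (analyticAt_const.sub (analyticAt_const.mul hS)).div
      (analyticAt_const.sub (analyticAt_const.mul hψ)) (one_sub_conj_mul_ne_zero hψ1 hψ1)
  have hHmax : IsLocalMax (norm ∘ H) z₀ := by
    have := eventually_nhdsWithin_iff.mp hstep
    filter_upwards [this] with z hz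
    by_cases hzz : z = z₀
    · rw [hzz]
    · exact (hz hzz).1
  have hconst := Complex.eventually_eq_of_isLocalMax_norm
    (hHan.eventually_analyticAt.mono fun z hz => hz.differentiableAt) hHmax
  obtain ⟨z, hz1, hz2⟩ := (hstep.and (nhdsWithin_le_nhds hconst)).exists
  exact hz1.2 hz2

/-- A Bloch–Cauchy type estimate for the multivalued inverse of `Φ`, obtained without choosing
branches: if `Φ` has no critical points over a closed disc and the preimage of that disc omits a
disc, then `deriv Φ` is bounded below at the preimages of the centre. -/
lemma le_norm_deriv_of_preimage_omits {Φ : ℂ → ℂ} (hΦ : Differentiable ℂ Φ) {p b : ℂ}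
    {r s c : ℝ} (hr : 0 < r) (hs : 0 < s) (hc : 0 < c)
    (hder : ∀ z, ‖Φ z - Φ p‖ ≤ r → c ≤ ‖deriv Φ z‖)
    (homit : ∀ z, ‖Φ z - Φ p‖ ≤ r → s < ‖z - b‖) :
    r * s / ‖p - b‖ ^ 2 ≤ ‖deriv Φ p‖ := by
  set S : ℂ → ℂ := fun z => (Φ z - Φ p) / r with hS
  set ψ : ℂ → ℂ := fun z => s / (z - b) with hψ
  set U : Set ℂ := {z | ‖Φ z - Φ p‖ ≤ r} with hU
  have hUcl : IsClosed U :=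
    isClosed_le ((hΦ.continuous.sub continuous_const).norm) continuous_const
  have hpU : p ∈ U := by simp [hU, hr.le]
  have hSd : Differentiable ℂ S := (hΦ.sub_const _).div_const _
  have hSder : ∀ z, deriv S z = deriv Φ z / r := fun z => by
    simp [hS, deriv_div_const, deriv_sub_const]
  have hSnorm : ∀ z, ‖S z‖ = ‖Φ z - Φ p‖ / r := fun z => by
    simp [hS, abs_of_pos hr]
  have hne : ∀ z ∈ U, z - b ≠ 0 := fun z hz => norm_pos_iff.mp (hs.trans (homit z hz))
  have hψan : ∀ z, z - b ≠ 0 → AnalyticAt ℂ ψ z := fun z hz =>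
    analyticAt_const.div (analyticAt_id.sub analyticAt_const) hz
  have hψder : ∀ z ∈ U, ‖deriv ψ z‖ = s / ‖z - b‖ ^ 2 := fun z hz => by
    have h := (hasDerivAt_const z (s : ℂ)).div ((hasDerivAt_id z).sub_const b) (hne z hz)
    have h' : deriv ψ z = _ := h.deriv
    rw [h']
    simp [abs_of_pos hs]
  have hψnorm : ∀ z, ‖ψ z‖ = s / ‖z - b‖ := fun z => by simp [hψ, abs_of_pos hs]
  have hψ1 : ∀ z ∈ U, ‖ψ z‖ < 1 := fun z hz => by
    rw [hψnorm, div_lt_one (hs.trans (homit z hz))]; exact homit z hz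
  have hS1 : ∀ z ∈ U, ‖S z‖ ≤ 1 := fun z hz => by
    rw [hSnorm, div_le_one hr]; exact hz
  have hS0 : ∀ z ∈ U, deriv S z ≠ 0 := fun z hz => by
    rw [hSder]
    exact div_ne_zero (norm_pos_iff.mp (hc.trans_le (hder z hz))) (by exact_mod_cast hr.ne')
  have hden : ∀ z ∈ U, 0 < ‖deriv S z‖ * (1 - ‖ψ z‖ ^ 2) := fun z hz =>
    mul_pos (norm_pos_iff.mpr (hS0 z hz)) (by nlinarith [hψ1 z hz, norm_nonneg (ψ z)])
  have hcont : ContinuousOn (metricRatio S ψ) U := by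
    intro z hz
    have h1 : ContinuousAt ψ z := (hψan z (hne z hz)).continuousAt
    have h2 : ContinuousAt (deriv ψ) z := (hψan z (hne z hz)).deriv.continuousAt
    have h3 : ContinuousAt S z := hSd.continuous.continuousAt
    have h4 : ContinuousAt (deriv S) z := (hSd.analyticAt z).deriv.continuousAt
    refine ContinuousAt.continuousWithinAt ?_
    exact (h2.norm.mul (continuousAt_const.sub (h3.norm.pow 2))).div
      (h4.norm.mul (continuousAt_const.sub (h1.norm.pow 2))) (hden z hz).ne'
  have hval : metricRatio S ψ p =
      s / ‖p - b‖ ^ 2 / (‖deriv S p‖ * (1 - ‖ψ p‖ ^ 2)) := by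
    have : S p = 0 := by simp [hS]
    rw [metricRatio, hψder p hpU, this]; simp
  have hpb : 0 < ‖p - b‖ := hs.trans (homit p hpU)
  have hpos : 0 < metricRatio S ψ p := by
    rw [hval]; exact div_pos (by positivity) (hden p hpU)
  have hfar : ∀ᶠ z in cocompact ℂ ⊓ 𝓟 U, metricRatio S ψ z ≤ metricRatio S ψ p := by
    set V := metricRatio S ψ p
    have h1 : ∀ᶠ z in cocompact ℂ, ‖b‖ + (1 + s ^ 2 + r / c * s / V) ≤ ‖z‖ :=
      (tendsto_norm_cocompact_atTop (E := ℂ)).eventually_ge_atTop _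
    rw [eventually_inf_principal]
    filter_upwards [h1] with z hz hzU
    have hzb : 1 + s ^ 2 + r / c * s / V ≤ ‖z - b‖ := by
      linarith [norm_sub_norm_le z b]
    have hq : 0 ≤ r / c * s / V := by positivity
    have hsz := homit z hzU
    have h2 : s ^ 2 + r / c * s / V ≤ ‖z - b‖ ^ 2 := by nlinarith [sq_nonneg s]
    have h3 : r / c * s ≤ V * (‖z - b‖ ^ 2 - s ^ 2) := by
      have : V * (r / c * s / V) = r / c * s := by field_simp
      nlinarith
    rw [metricRatio, div_le_iff₀ (hden z hzU), hψder z hzU, hψnorm, hSder, norm_div (deriv Φ z),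
      Complex.norm_real, Real.norm_of_nonneg hr.le]
    have hzb0 : 0 < ‖z - b‖ := hs.trans hsz
    have h4 : s / ‖z - b‖ ^ 2 * (1 - ‖S z‖ ^ 2) ≤ s / ‖z - b‖ ^ 2 :=
      mul_le_of_le_one_right (by positivity) (by nlinarith [sq_nonneg ‖S z‖])
    refine h4.trans ?_
    have h5 : 0 ≤ 1 - (s / ‖z - b‖) ^ 2 := by
      have := hψ1 z hzU
      rw [hψnorm] at this
      have h0 : 0 ≤ s / ‖z - b‖ := by positivity
      nlinarith
    have h6 : V * (c / r * (1 - (s / ‖z - b‖) ^ 2)) ≤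
        V * (‖deriv Φ z‖ / r * (1 - (s / ‖z - b‖) ^ 2)) := by
      gcongr
      exact hder z hzU
    refine le_trans ?_ h6
    have h7 : V * (c / r * (1 - (s / ‖z - b‖) ^ 2)) =
        c / r * (V * (‖z - b‖ ^ 2 - s ^ 2)) / ‖z - b‖ ^ 2 := by
      field_simp
    rw [h7]
    gcongr
    calc s = c / r * (r / c * s) := by field_simp
      _ ≤ _ := by gcongr
  obtain ⟨z₀, hz₀, hmax⟩ := hcont.exists_isMaxOn' hUcl hpU hfar
  have hz₀pos : 0 < metricRatio S ψ z₀ := hpos.trans_le (hmax hpU)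
  have hS0lt : ‖S z₀‖ < 1 := by
    refine lt_of_le_of_ne (hS1 z₀ hz₀) fun h => ?_
    rw [metricRatio, h] at hz₀pos
    simp at hz₀pos
  have hUn : U ∈ 𝓝 z₀ := by
    have : ∀ᶠ z in 𝓝 z₀, ‖S z‖ < 1 :=
      hSd.continuous.continuousAt.norm.eventually_lt_const hS0lt
    filter_upwards [this] with z hz
    rw [hSnorm, div_lt_one hr] at hz
    exact hz.le
  have hle := metricRatio_le_one_of_isLocalMax (hSd.analyticAt z₀) (hψan z₀ (hne z₀ hz₀)) hS0lt
    (hψ1 z₀ hz₀) (hS0 z₀ hz₀) (hmax.isLocalMax hUn)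
  have hp1 : metricRatio S ψ p ≤ 1 := (hmax hpU).trans hle
  rw [hval, div_le_one (hden p hpU), hSder, norm_div, Complex.norm_real,
    Real.norm_of_nonneg hr.le] at hp1
  have h8 : ‖deriv Φ p‖ / r * (1 - ‖ψ p‖ ^ 2) ≤ ‖deriv Φ p‖ / r :=
    mul_le_of_le_one_right (by positivity) (by nlinarith [sq_nonneg ‖ψ p‖])
  have h9 := hp1.trans h8
  rw [le_div_iff₀ hr] at h9
  calc r * s / ‖p - b‖ ^ 2 = s / ‖p - b‖ ^ 2 * r := by ring
    _ ≤ _ := h9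

/-- The lift of the Arnol'd circle map, extended to an entire function. -/
def arnoldC (τ ε : ℝ) (z : ℂ) : ℂ := z + τ - ε * Complex.sin (2 * π * z)

lemma hasDerivAt_arnoldC (τ ε : ℝ) (z : ℂ) :
    HasDerivAt (arnoldC τ ε) (1 - 2 * π * ε * Complex.cos (2 * π * z)) z := by
  have h1 : HasDerivAt (fun z : ℂ => 2 * π * z) (2 * π) z := by
    simpa using (hasDerivAt_id z).const_mul (2 * π : ℂ)
  have h := ((hasDerivAt_id z).add_const (τ : ℂ)).sub ((h1.csin).const_mul (ε : ℂ))
  refine h.congr_deriv ?_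
  ring

lemma deriv_arnoldC (τ ε : ℝ) (z : ℂ) :
    deriv (arnoldC τ ε) z = 1 - 2 * π * ε * Complex.cos (2 * π * z) :=
  (hasDerivAt_arnoldC τ ε z).deriv

lemma differentiable_arnoldC (τ ε : ℝ) : Differentiable ℂ (arnoldC τ ε) :=
  fun z => (hasDerivAt_arnoldC τ ε z).differentiableAt

lemma differentiable_iterate_arnoldC (τ ε : ℝ) (n : ℕ) : Differentiable ℂ (arnoldC τ ε)^[n] :=
  (differentiable_arnoldC τ ε).iterate n

lemma arnoldC_add_int (τ ε : ℝ) (z : ℂ) (k : ℤ) :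
    arnoldC τ ε (z + k) = arnoldC τ ε z + k := by
  have : (2 * π * (z + k) : ℂ) = 2 * π * z + k * (2 * π) := by ring
  rw [arnoldC, arnoldC, this, Complex.sin_add_int_mul_two_pi]
  ring

lemma iterate_arnoldC_add_int (τ ε : ℝ) (n : ℕ) (z : ℂ) (k : ℤ) :
    (arnoldC τ ε)^[n] (z + k) = (arnoldC τ ε)^[n] z + k := by
  induction n generalizing z with
  | zero => rfl
  | succ n ih => rw [iterate_succ_apply, iterate_succ_apply, arnoldC_add_int, ih]

lemma deriv_iterate_arnoldC_add_int (τ ε : ℝ) (n : ℕ) (z : ℂ) (k : ℤ) :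
    deriv (arnoldC τ ε)^[n] (z + k) = deriv (arnoldC τ ε)^[n] z := by
  rw [← deriv_comp_add_const]
  simp_rw [iterate_arnoldC_add_int]
  rw [deriv_add_const]

lemma arnoldC_conj (τ ε : ℝ) (z : ℂ) :
    arnoldC τ ε ((starRingEnd ℂ) z) = (starRingEnd ℂ) (arnoldC τ ε z) := by
  simp only [arnoldC, map_sub, map_add, map_mul, Complex.conj_ofReal, ← Complex.sin_conj]
  rw [map_ofNat]

lemma iterate_arnoldC_conj (τ ε : ℝ) (n : ℕ) (z : ℂ) :
    (arnoldC τ ε)^[n] ((starRingEnd ℂ) z) = (starRingEnd ℂ) ((arnoldC τ ε)^[n] z) := by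
  induction n generalizing z with
  | zero => rfl
  | succ n ih => rw [iterate_succ_apply, iterate_succ_apply, arnoldC_conj, ih]

/-- Up to integer translation and conjugation, there is only one critical point. -/
lemma exists_critical_point (τ ε : ℝ) (h0 : 0 < ε) (h1 : 2 * π * ε < 1) :
    ∃ c : ℂ, ∀ z, deriv (arnoldC τ ε) z = 0 →
      ∃ k : ℤ, z = c + k ∨ z = (starRingEnd ℂ) c + k := by
  have hπ := Real.pi_pos
  have ha : (2 * π * ε : ℂ) ≠ 0 := by
    have : (2 * π * ε : ℝ) ≠ 0 := by positivity
    exact_mod_cast this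
  have h2π : (2 * π : ℂ) ≠ 0 := fun h => ha (by rw [h, zero_mul])
  have hcrit : ∀ z, deriv (arnoldC τ ε) z = 0 ↔ Complex.cos (2 * π * z) = 1 / (2 * π * ε) := by
    intro z
    rw [deriv_arnoldC, sub_eq_zero, eq_div_iff ha, mul_comm (Complex.cos _), eq_comm]
  obtain ⟨w, hw⟩ := Complex.cos_surjective (1 / (2 * π * ε))
  set c := w / (2 * π) with hc
  have hcw : 2 * π * c = w := by rw [hc]; field_simp
  have hcos : Complex.cos (2 * π * c) = 1 / (2 * π * ε) := by rw [hcw, hw]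
  have hsol : ∀ z z' : ℂ, Complex.cos (2 * π * z) = Complex.cos (2 * π * z') →
      ∃ k : ℤ, z' = z + k ∨ z' = -z + k := by
    intro z z' h
    obtain ⟨k, hk⟩ := Complex.cos_eq_cos_iff.mp h
    refine ⟨k, hk.imp (fun h => ?_) fun h => ?_⟩
    · exact mul_left_cancel₀ h2π (by rw [h]; ring)
    · exact mul_left_cancel₀ h2π (by rw [h]; ring)
  have hconj : Complex.cos (2 * π * (starRingEnd ℂ) c) = Complex.cos (2 * π * c) := by
    have : (2 * π * (starRingEnd ℂ) c : ℂ) = (starRingEnd ℂ) (2 * π * c) := by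
      rw [map_mul, map_mul, map_ofNat, Complex.conj_ofReal]
    rw [this, Complex.cos_conj, hcos, map_div₀, map_mul, map_mul, map_ofNat, map_one,
      Complex.conj_ofReal, Complex.conj_ofReal]
  refine ⟨c, fun z hz => ?_⟩
  rw [hcrit, ← hcos] at hz
  obtain ⟨k, hk | hk⟩ := hsol _ _ hz.symm
  · exact ⟨k, Or.inl hk⟩
  obtain ⟨m, hm | hm⟩ := hsol _ _ hconj.symm
  · exfalso
    have him : c.im = 0 := by
      have := congrArg Complex.im hm
      simp at this
      linarith
    have hre : c = (c.re : ℂ) := by apply Complex.ext <;> simp [him]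
    rw [hre] at hcos
    have : Real.cos (2 * π * c.re) = 1 / (2 * π * ε) := by exact_mod_cast hcos
    have hle := Real.cos_le_one (2 * π * c.re)
    rw [this, div_le_one (by positivity)] at hle
    linarith
  · refine ⟨k - m, Or.inr ?_⟩
    rw [hk, hm]; push_cast; ring

lemma exp_abs_sub_one_le_norm_cos (w : ℂ) :
    (Real.exp |w.im| - 1) / 2 ≤ ‖Complex.cos w‖ := by
  have h1 : ‖Complex.exp (w * Complex.I)‖ = Real.exp (-w.im) := by simp [Complex.norm_exp]
  have h2 : ‖Complex.exp (-w * Complex.I)‖ = Real.exp w.im := by simp [Complex.norm_exp]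
  have h3 : ‖Complex.cos w‖ = ‖Complex.exp (w * Complex.I) + Complex.exp (-w * Complex.I)‖ / 2 := by
    rw [Complex.cos, norm_div]; simp
  rw [h3]
  gcongr
  rcases abs_cases w.im with ⟨h, h'⟩ | ⟨h, h'⟩
  · have := norm_sub_norm_le (Complex.exp (-w * Complex.I)) (-Complex.exp (w * Complex.I))
    rw [norm_neg, h1, h2, sub_neg_eq_add, add_comm (Complex.exp (-w * Complex.I))] at this
    have h4 : Real.exp (-w.im) ≤ 1 := Real.exp_le_one_iff.mpr (by linarith)
    rw [h]; linarith
  · have := norm_sub_norm_le (Complex.exp (w * Complex.I)) (-Complex.exp (-w * Complex.I))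
    rw [norm_neg, h1, h2, sub_neg_eq_add] at this
    have h4 : Real.exp w.im ≤ 1 := Real.exp_le_one_iff.mpr (by linarith)
    rw [h]; linarith

lemma exists_one_le_norm_deriv_arnoldC (τ ε : ℝ) (h0 : 0 < ε) :
    ∃ Y : ℝ, ∀ z : ℂ, Y ≤ |z.im| → 1 ≤ ‖deriv (arnoldC τ ε) z‖ := by
  have hπ := Real.pi_pos
  refine ⟨2 / (π * ε) / (2 * π), fun z hz => ?_⟩
  rw [deriv_arnoldC]
  have h1 := exp_abs_sub_one_le_norm_cos (2 * π * z)
  have him : (2 * π * z : ℂ).im = 2 * π * z.im := by simp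
  rw [him, abs_mul, abs_of_pos (by positivity : 0 < 2 * π)] at h1
  rw [div_le_iff₀ (by positivity)] at hz
  have h2 := Real.add_one_le_exp (2 * π * |z.im|)
  have h3 : 2 / (π * ε) / 2 ≤ ‖Complex.cos (2 * π * z)‖ := by linarith
  have h4 := norm_sub_norm_le (2 * π * ε * Complex.cos (2 * π * z)) 1
  rw [norm_sub_rev] at h4
  have h5 : ‖(2 * π * ε * Complex.cos (2 * π * z) : ℂ)‖ =
      2 * π * ε * ‖Complex.cos (2 * π * z)‖ := by
    simp [abs_of_pos hπ, abs_of_pos h0]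
  rw [h5, norm_one] at h4
  have h6 : 2 * π * ε * (2 / (π * ε) / 2) = 2 := by field_simp
  have h7 : 2 * π * ε * (2 / (π * ε) / 2) ≤ 2 * π * ε * ‖Complex.cos (2 * π * z)‖ := by gcongr
  linarith

lemma exists_pos_le_norm_deriv_arnoldC (τ ε : ℝ) (h0 : 0 < ε) {S : Set ℂ} (hS : IsClosed S)
    (hper : ∀ z ∈ S, ∀ k : ℤ, z + k ∈ S) (hne : ∀ z ∈ S, deriv (arnoldC τ ε) z ≠ 0) :
    ∃ c > 0, ∀ z ∈ S, c ≤ ‖deriv (arnoldC τ ε) z‖ := by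
  obtain ⟨Y, hY⟩ := exists_one_le_norm_deriv_arnoldC τ ε h0
  have hK : IsCompact (S ∩ (Icc (0 : ℝ) 1 ×ℂ Icc (-Y) Y)) :=
    (isCompact_Icc.reProdIm isCompact_Icc).inter_left hS
  have hcont : Continuous fun z => ‖deriv (arnoldC τ ε) z‖ := by
    simp_rw [deriv_arnoldC]; fun_prop
  obtain ⟨c, hc, hc'⟩ := hK.exists_forall_le' hcont.continuousOn (a := 0)
    fun z hz => norm_pos_iff.mpr (hne z hz.1)
  refine ⟨min c 1, lt_min hc one_pos, fun z hz => ?_⟩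
  by_cases hzY : Y ≤ |z.im|
  · exact (min_le_right _ _).trans (hY z hzY)
  · push Not at hzY
    have hmem := hper z hz (-⌊z.re⌋)
    have hd : deriv (arnoldC τ ε) (z + (-⌊z.re⌋ : ℤ)) = deriv (arnoldC τ ε) z :=
      deriv_iterate_arnoldC_add_int τ ε 1 z _
    rw [← hd]
    refine (min_le_left _ _).trans (hc' _ ⟨hmem, ?_⟩)
    rw [Complex.mem_reProdIm]
    refine ⟨?_, ?_⟩
    · have h1 := Int.floor_le z.re
      have h2 := Int.lt_floor_add_one z.re
      simp only [Complex.add_re, Complex.intCast_re, mem_Icc]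
      push_cast
      constructor <;> linarith
    · have := abs_lt.mp hzY
      simp only [Complex.add_im, Complex.intCast_im, add_zero, mem_Icc]
      constructor <;> linarith

lemma exists_pos_le_norm_deriv_iterate_arnoldC (τ ε : ℝ) (h0 : 0 < ε) {B T : Set ℂ}
    (hB : ∀ z, arnoldC τ ε z ∈ B → z ∈ B) (hcrit : ∀ z ∈ B, deriv (arnoldC τ ε) z ≠ 0)
    (hT : IsClosed T) (hper : ∀ z ∈ T, ∀ k : ℤ, z + k ∈ T) (hTB : T ⊆ B) (n : ℕ) :
    ∃ c > 0, ∀ z, (arnoldC τ ε)^[n] z ∈ T → c ≤ ‖deriv (arnoldC τ ε)^[n] z‖ := by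
  induction n with
  | zero => exact ⟨1, one_pos, fun z _ => by simp⟩
  | succ n ih =>
    obtain ⟨c, hc, hcz⟩ := ih
    have hBn : ∀ m z, (arnoldC τ ε)^[m] z ∈ B → z ∈ B := by
      intro m
      induction m with
      | zero => exact fun z hz => hz
      | succ m ihm => exact fun z hz => hB z (ihm _ hz)
    obtain ⟨d, hd, hdz⟩ := exists_pos_le_norm_deriv_arnoldC τ ε h0
      (S := (arnoldC τ ε)^[n + 1] ⁻¹' T)
      (hT.preimage (differentiable_iterate_arnoldC τ ε _).continuous)
      (fun z hz k => by
        rw [mem_preimage, iterate_arnoldC_add_int]; exact hper _ hz k)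
      (fun z hz => hcrit z (hBn _ z (hTB hz)))
    refine ⟨c * d, mul_pos hc hd, fun z hz => ?_⟩
    rw [iterate_succ, deriv_comp _ (differentiable_iterate_arnoldC τ ε n _)
      (differentiable_arnoldC τ ε z), norm_mul]
    exact mul_le_mul (hcz _ hz) (hdz z hz) hd.le (norm_nonneg _)

/-- The points whose orbit, observed every `q` steps and modulo `1`, converges to `p`. -/
def arnoldBasin (τ ε : ℝ) (p : ℂ) (q : ℕ) : Set ℂ :=
  {z | ∃ (j : ℕ) (l : ℕ → ℤ), Tendsto (fun n => (arnoldC τ ε)^[q * n + j] z - l n) atTop (𝓝 p)}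

lemma mem_arnoldBasin_of_iterate {τ ε : ℝ} {p : ℂ} {q : ℕ} (k : ℕ) {z : ℂ}
    (h : (arnoldC τ ε)^[k] z ∈ arnoldBasin τ ε p q) : z ∈ arnoldBasin τ ε p q := by
  obtain ⟨j, l, h⟩ := h
  refine ⟨j + k, l, h.congr fun n => ?_⟩
  rw [← iterate_add_apply, add_assoc]

lemma add_int_mem_arnoldBasin {τ ε : ℝ} {p : ℂ} {q : ℕ} {z : ℂ} (h : z ∈ arnoldBasin τ ε p q)
    (k : ℤ) : z + k ∈ arnoldBasin τ ε p q := by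
  obtain ⟨j, l, h⟩ := h
  refine ⟨j, fun n => l n + k, h.congr fun n => ?_⟩
  rw [iterate_arnoldC_add_int]; push_cast; ring

lemma conj_mem_arnoldBasin {τ ε p : ℝ} {q : ℕ} {z : ℂ} (h : z ∈ arnoldBasin τ ε p q) :
    (starRingEnd ℂ) z ∈ arnoldBasin τ ε p q := by
  obtain ⟨j, l, h⟩ := h
  refine ⟨j, l, ?_⟩
  have h' := (Complex.continuous_conj.tendsto (p : ℂ)).comp h
  rw [Complex.conj_ofReal] at h'
  refine h'.congr fun n => ?_
  simp [iterate_arnoldC_conj]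

/-- Basins of different cycles are disjoint. -/
lemma exists_iterate_eq_of_mem_arnoldBasin {τ ε : ℝ} {p₁ p₂ z : ℂ} {q₁ q₂ : ℕ} (hq₁ : 0 < q₁)
    (hq₂ : 0 < q₂) (h₁ : z ∈ arnoldBasin τ ε p₁ q₁) (h₂ : z ∈ arnoldBasin τ ε p₂ q₂) :
    ∃ (d : ℕ) (l : ℤ), (arnoldC τ ε)^[d] p₁ = p₂ + l ∨ (arnoldC τ ε)^[d] p₂ = p₁ + l := by
  obtain ⟨j₁, l₁, h₁⟩ := h₁
  obtain ⟨j₂, l₂, h₂⟩ := h₂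
  have t₁ := h₁.comp (tendsto_id.const_mul_atTop' hq₂)
  have t₂ := h₂.comp (tendsto_id.const_mul_atTop' hq₁)
  have key : ∀ {a b : ℂ} {q j k : ℕ} {l m : ℕ → ℤ},
      Tendsto (fun n => (arnoldC τ ε)^[q * n + j] z - l n) atTop (𝓝 a) →
      Tendsto (fun n => (arnoldC τ ε)^[q * n + (j + k)] z - m n) atTop (𝓝 b) →
      ∃ r : ℤ, (arnoldC τ ε)^[k] a = b + r := by
    intro a b q j k l m ha hb
    have hc := ((differentiable_iterate_arnoldC τ ε k).continuous.tendsto a).comp ha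
    have hlim : Tendsto (fun n => ((m n - l n : ℤ) : ℂ)) atTop
        (𝓝 ((arnoldC τ ε)^[k] a - b)) := by
      refine (hc.sub hb).congr fun n => ?_
      have e : (arnoldC τ ε)^[q * n + j] z - l n = (arnoldC τ ε)^[q * n + j] z + (-l n : ℤ) := by
        push_cast; ring
      rw [comp_apply, e, iterate_arnoldC_add_int, ← iterate_add_apply,
        show k + (q * n + j) = q * n + (j + k) by ring]
      push_cast; ring
    have hcl : IsClosed (range ((↑) : ℤ → ℂ)) := Complex.isClosedEmbedding_intCast.isClosed_range
    obtain ⟨r, hr⟩ := hcl.mem_of_tendsto hlim (Eventually.of_forall fun n => mem_range_self _)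
    exact ⟨r, by rw [hr]; ring⟩
  rcases le_total j₁ j₂ with hj | hj
  · obtain ⟨r, hr⟩ := key (q := q₁ * q₂) (j := j₁) (k := j₂ - j₁) (l := fun n => l₁ (q₂ * n))
      (m := fun n => l₂ (q₁ * n)) (a := p₁) (b := p₂)
      (t₁.congr fun n => by simp [mul_assoc])
      (t₂.congr fun n => by
        simp [Nat.add_sub_cancel' hj, show q₂ * (q₁ * n) = q₁ * q₂ * n by ring])
    exact ⟨_, r, Or.inl hr⟩
  · obtain ⟨r, hr⟩ := key (q := q₁ * q₂) (j := j₂) (k := j₁ - j₂) (l := fun n => l₂ (q₁ * n))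
      (m := fun n => l₁ (q₂ * n)) (a := p₂) (b := p₁)
      (t₂.congr fun n => by simp [show q₂ * (q₁ * n) = q₁ * q₂ * n by ring])
      (t₁.congr fun n => by
        simp [Nat.add_sub_cancel' hj, mul_assoc])
    exact ⟨_, r, Or.inr hr⟩

lemma iterate_mul_arnoldC_eq {τ ε : ℝ} {p : ℂ} {q : ℕ} {l : ℤ}
    (hp : (arnoldC τ ε)^[q] p = p + l) (n : ℕ) :
    (arnoldC τ ε)^[q * n] p = p + (n * l : ℤ) := by
  induction n with
  | zero => simp
  | succ n ih =>
    rw [mul_add, mul_one, iterate_add_apply, hp, iterate_arnoldC_add_int, ih]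
    push_cast; ring

lemma deriv_iterate_mul_arnoldC {τ ε : ℝ} {p : ℂ} {q : ℕ} {l : ℤ}
    (hp : (arnoldC τ ε)^[q] p = p + l) (n : ℕ) :
    deriv (arnoldC τ ε)^[q * n] p = deriv (arnoldC τ ε)^[q] p ^ n := by
  induction n with
  | zero => simp
  | succ n ih =>
    rw [mul_add, mul_one, iterate_add, deriv_comp _ (differentiable_iterate_arnoldC τ ε _ _)
      (differentiable_iterate_arnoldC τ ε _ _), hp, deriv_iterate_arnoldC_add_int, ih, pow_succ]

/-- An attracting cycle has a basin containing a disc. -/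
lemma exists_closedBall_subset_arnoldBasin {τ ε : ℝ} {p : ℂ} {q : ℕ} {l : ℤ}
    (hp : (arnoldC τ ε)^[q] p = p + l) (hd : ‖deriv (arnoldC τ ε)^[q] p‖ < 1) :
    ∃ r > 0, Metric.closedBall p r ⊆ arnoldBasin τ ε p q := by
  obtain ⟨μ, hμ, hμ1⟩ := exists_between hd
  have hμ0 : 0 ≤ μ := (norm_nonneg _).trans hμ.le
  have hder := (differentiable_iterate_arnoldC τ ε q p).hasDerivAt
  have hev : ∀ᶠ z in 𝓝 p,
      ‖(arnoldC τ ε)^[q] z - (arnoldC τ ε)^[q] p‖ ≤ μ * ‖z - p‖ := by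
    have h1 := hder.isLittleO.def (sub_pos.mpr hμ)
    filter_upwards [h1] with z hz
    have h2 : (arnoldC τ ε)^[q] z - (arnoldC τ ε)^[q] p =
        ((arnoldC τ ε)^[q] z - (arnoldC τ ε)^[q] p - (z - p) • deriv (arnoldC τ ε)^[q] p) +
          (z - p) • deriv (arnoldC τ ε)^[q] p := by ring
    rw [h2]
    refine (norm_add_le _ _).trans ?_
    rw [norm_smul]
    nlinarith
  obtain ⟨r, hr, hball⟩ := Metric.nhds_basis_closedBall.mem_iff.mp hev
  refine ⟨r, hr, fun z hz => ⟨0, fun n => n * l, ?_⟩⟩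
  have hstep : ∀ n : ℕ, ‖(arnoldC τ ε)^[q * n] z - (n * l : ℤ) - p‖ ≤ μ ^ n * ‖z - p‖ := by
    intro n
    induction n with
    | zero => simp
    | succ n ih =>
      set w : ℂ := (arnoldC τ ε)^[q * n] z - (n * l : ℤ) with hw
      have hwb : w ∈ Metric.closedBall p r := by
        rw [mem_closedBall_iff_norm] at hz ⊢
        refine ih.trans ?_
        have := pow_le_one₀ hμ0 hμ1.le (n := n)
        nlinarith [norm_nonneg (z - p)]
      have h1 : ‖(arnoldC τ ε)^[q] w - (arnoldC τ ε)^[q] p‖ ≤ μ * ‖w - p‖ := hball hwb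
      have h2 : (arnoldC τ ε)^[q * (n + 1)] z - ((n + 1 : ℕ) * l : ℤ) - p =
          (arnoldC τ ε)^[q] w - (arnoldC τ ε)^[q] p := by
        have h3 : w = (arnoldC τ ε)^[q * n] z + (-(n * l) : ℤ) := by
          rw [hw]; push_cast; ring
        rw [hp, h3, iterate_arnoldC_add_int, ← iterate_add_apply,
          show q + q * n = q * (n + 1) by ring]
        push_cast; ring
      rw [h2, pow_succ]
      calc _ ≤ μ * ‖w - p‖ := h1
        _ ≤ μ * (μ ^ n * ‖z - p‖) := by gcongr
        _ = _ := by ring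
  have h0 : Tendsto (fun n : ℕ => μ ^ n * ‖z - p‖) atTop (𝓝 0) := by
    simpa using (tendsto_pow_atTop_nhds_zero_of_lt_one hμ0 hμ1).mul_const ‖z - p‖
  rw [tendsto_iff_norm_sub_tendsto_zero]
  exact squeeze_zero (fun n => norm_nonneg _) hstep h0

open scoped Pointwise in
/-- Fatou's theorem for the Arnol'd family, in contrapositive form: an attracting cycle whose
basin omits a disc has a critical point in its basin. -/
lemma exists_critical_point_mem_arnoldBasin {τ ε : ℝ} (hε : 0 < ε) {p b : ℂ} {q : ℕ} {l : ℤ}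
    {s : ℝ} (hs : 0 < s) (hp : (arnoldC τ ε)^[q] p = p + l)
    (hd : ‖deriv (arnoldC τ ε)^[q] p‖ < 1)
    (homit : ∀ z ∈ Metric.closedBall b s, z ∉ arnoldBasin τ ε p q) :
    ∃ z ∈ arnoldBasin τ ε p q, deriv (arnoldC τ ε) z = 0 := by
  by_contra! hcrit
  obtain ⟨r, hr, hball⟩ := exists_closedBall_subset_arnoldBasin hp hd
  set T : Set ℂ := Metric.closedBall p r + range ((↑) : ℤ → ℂ) with hT
  have hTcl : IsClosed T :=
    Complex.isClosedEmbedding_intCast.isClosed_range.add_left_of_isCompact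
      (isCompact_closedBall p r)
  have hTB : T ⊆ arnoldBasin τ ε p q := by
    rintro _ ⟨z, hz, _, ⟨k, rfl⟩, rfl⟩
    exact add_int_mem_arnoldBasin (hball hz) k
  have hTper : ∀ z ∈ T, ∀ k : ℤ, z + k ∈ T := by
    rintro _ ⟨z, hz, _, ⟨m, rfl⟩, rfl⟩ k
    exact ⟨z, hz, _, ⟨m + k, rfl⟩, by push_cast; ring⟩
  have hmemT : ∀ (n : ℕ) z, ‖(arnoldC τ ε)^[q * n] z - (arnoldC τ ε)^[q * n] p‖ ≤ r →
      (arnoldC τ ε)^[q * n] z ∈ T := by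
    intro n z hz
    rw [iterate_mul_arnoldC_eq hp n] at hz
    refine ⟨(arnoldC τ ε)^[q * n] z - (n * l : ℤ), ?_, _, ⟨n * l, rfl⟩, by simp⟩
    rw [mem_closedBall_iff_norm]
    rwa [sub_sub, add_comm _ p]
  have hbound : ∀ n : ℕ, r * s / ‖p - b‖ ^ 2 ≤ ‖deriv (arnoldC τ ε)^[q] p‖ ^ n := by
    intro n
    obtain ⟨c, hc, hcz⟩ := exists_pos_le_norm_deriv_iterate_arnoldC τ ε hε
      (fun z hz => mem_arnoldBasin_of_iterate 1 hz) hcrit hTcl hTper hTB (q * n)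
    rw [← norm_pow (deriv (arnoldC τ ε)^[q] p) n, ← deriv_iterate_mul_arnoldC hp]
    refine le_norm_deriv_of_preimage_omits (differentiable_iterate_arnoldC τ ε _) hr hs hc
      (fun z hz => hcz z (hmemT n z hz)) fun z hz => ?_
    by_contra! hle
    exact homit z (mem_closedBall_iff_norm.mpr hle)
      (mem_arnoldBasin_of_iterate _ (hTB (hmemT n z hz)))
  have hlim := tendsto_pow_atTop_nhds_zero_of_lt_one (norm_nonneg _) hd
  have h0 : r * s / ‖p - b‖ ^ 2 ≤ 0 := ge_of_tendsto' hlim hbound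
  have hpb : 0 < ‖p - b‖ := by
    rw [norm_pos_iff, sub_ne_zero]
    rintro rfl
    exact homit p (Metric.mem_closedBall_self hs.le)
      (hball (Metric.mem_closedBall_self hr.le))
  have : 0 < r * s / ‖p - b‖ ^ 2 := by positivity
  linarith

/-- The Arnol'd map has at most one real attracting cycle. -/
lemma exists_iterate_eq_of_attracting {τ ε : ℝ} (hε : 0 < ε) (hε1 : 2 * π * ε < 1)
    {p₁ p₂ : ℝ} {q₁ q₂ : ℕ} {l₁ l₂ : ℤ} (hq₁ : 0 < q₁) (hq₂ : 0 < q₂)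
    (hp₁ : (arnoldC τ ε)^[q₁] p₁ = p₁ + l₁) (hd₁ : ‖deriv (arnoldC τ ε)^[q₁] p₁‖ < 1)
    (hp₂ : (arnoldC τ ε)^[q₂] p₂ = p₂ + l₂) (hd₂ : ‖deriv (arnoldC τ ε)^[q₂] p₂‖ < 1) :
    ∃ (d : ℕ) (l : ℤ), (arnoldC τ ε)^[d] p₁ = p₂ + l ∨ (arnoldC τ ε)^[d] p₂ = p₁ + l := by
  by_contra hcon
  have hdisj : ∀ z, z ∈ arnoldBasin τ ε p₁ q₁ → z ∉ arnoldBasin τ ε p₂ q₂ := fun z h₁ h₂ =>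
    hcon (exists_iterate_eq_of_mem_arnoldBasin hq₁ hq₂ h₁ h₂)
  obtain ⟨r₁, hr₁, hb₁⟩ := exists_closedBall_subset_arnoldBasin hp₁ hd₁
  obtain ⟨r₂, hr₂, hb₂⟩ := exists_closedBall_subset_arnoldBasin hp₂ hd₂
  obtain ⟨z₁, hz₁, hc₁⟩ := exists_critical_point_mem_arnoldBasin hε hr₂ hp₁ hd₁
    fun z hz hz' => hdisj z hz' (hb₂ hz)
  obtain ⟨z₂, hz₂, hc₂⟩ := exists_critical_point_mem_arnoldBasin hε hr₁ hp₂ hd₂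
    fun z hz hz' => hdisj z (hb₁ hz) hz'
  obtain ⟨c, hc⟩ := exists_critical_point τ ε hε hε1
  have hmem : ∀ {p : ℝ} {q : ℕ} {z : ℂ}, z ∈ arnoldBasin τ ε p q →
      deriv (arnoldC τ ε) z = 0 → c ∈ arnoldBasin τ ε p q := by
    intro p q z hz hz0
    obtain ⟨k, rfl | rfl⟩ := hc z hz0
    · simpa using add_int_mem_arnoldBasin hz (-k)
    · have := add_int_mem_arnoldBasin hz (-k)
      simpa using conj_mem_arnoldBasin this
  exact hdisj c (hmem hz₁ hc₁) (hmem hz₂ hc₂)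

/-- The lift of the Arnol'd circle map to the real line. -/
def arnoldR (τ ε x : ℝ) : ℝ := x + τ - ε * Real.sin (2 * π * x)

lemma iterate_arnoldC_ofReal (τ ε : ℝ) (n : ℕ) (x : ℝ) :
    (arnoldC τ ε)^[n] x = ((arnoldR τ ε)^[n] x : ℝ) := by
  induction n generalizing x with
  | zero => rfl
  | succ n ih =>
    have h : arnoldC τ ε x = (arnoldR τ ε x : ℝ) := by simp [arnoldC, arnoldR]
    rw [iterate_succ_apply, iterate_succ_apply, h, ih]

lemma differentiable_arnoldR (τ ε : ℝ) : Differentiable ℝ (arnoldR τ ε) := by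
  unfold arnoldR; fun_prop

lemma strictMono_arnoldR {τ ε : ℝ} (hε : 0 < ε) (hε1 : 2 * π * ε < 1) :
    StrictMono (arnoldR τ ε) := by
  refine strictMono_of_deriv_pos fun x => ?_
  have h1 : HasDerivAt (fun x : ℝ => 2 * π * x) (2 * π) x := by
    simpa using (hasDerivAt_id x).const_mul (2 * π)
  have h := ((hasDerivAt_id x).add_const τ).sub ((h1.sin).const_mul ε)
  have h' : HasDerivAt (arnoldR τ ε) (1 - ε * (Real.cos (2 * π * x) * (2 * π))) x := h
  rw [h'.deriv]
  have := Real.cos_le_one (2 * π * x)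
  have hπ : 0 < 2 * π * ε := by positivity
  nlinarith

lemma continuous_iterate_arnoldR (ε : ℝ) (n : ℕ) :
    Continuous fun p : ℝ × ℝ => (arnoldR p.1 ε)^[n] p.2 := by
  induction n with
  | zero => exact continuous_snd
  | succ n ih =>
    simp_rw [iterate_succ_apply']
    unfold arnoldR at ih ⊢
    fun_prop

lemma iterate_arnoldR_add_le {ε : ℝ} (hε : 0 < ε) (hε1 : 2 * π * ε < 1) {t t' : ℝ} (ht : t ≤ t')
    {n : ℕ} (hn : 0 < n) (x : ℝ) :
    (arnoldR t ε)^[n] x + (t' - t) ≤ (arnoldR t' ε)^[n] x := by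
  obtain ⟨n, rfl⟩ := Nat.exists_eq_succ_of_ne_zero hn.ne'
  have hstep : ∀ y, arnoldR t ε y + (t' - t) = arnoldR t' ε y := fun y => by
    unfold arnoldR; ring
  have hle : (arnoldR t ε)^[n] x ≤ (arnoldR t' ε)^[n] x :=
    (strictMono_arnoldR hε hε1).monotone.iterate_le_of_le
      (fun y => by have := hstep y; linarith) n x
  rw [iterate_succ_apply', iterate_succ_apply', hstep]
  exact (strictMono_arnoldR hε hε1).monotone hle

lemma norm_deriv_iterate_arnoldC_ofReal {τ ε : ℝ} (hε : 0 < ε) (hε1 : 2 * π * ε < 1) (n : ℕ)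
    (x : ℝ) : ‖deriv (arnoldC τ ε)^[n] x‖ = deriv (arnoldR τ ε)^[n] x := by
  have h1 := ((differentiable_iterate_arnoldC τ ε n x).hasDerivAt).comp_ofReal
  have h2 := (((differentiable_arnoldR τ ε).iterate n x).hasDerivAt).ofReal_comp
  simp_rw [iterate_arnoldC_ofReal] at h1
  rw [h1.unique h2, Complex.norm_real, Real.norm_of_nonneg]
  exact ((strictMono_arnoldR hε hε1).monotone.iterate n).deriv_nonneg

lemma nonneg_of_hasDerivAt_of_le_right {g : ℝ → ℝ} {v t : ℝ} (hg : HasDerivAt g v t)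
    (h : ∀ᶠ s in 𝓝[>] t, g t ≤ g s) : 0 ≤ v := by
  have hs := (hasDerivWithinAt_iff_tendsto_slope' (self_notMem_Ioi (a := t))).mp
    (hg.hasDerivWithinAt (s := Ioi t))
  refine ge_of_tendsto hs ?_
  filter_upwards [h, self_mem_nhdsWithin] with s hs hts
  rw [slope_def_field]
  exact div_nonneg (sub_nonneg.mpr hs) (sub_nonneg.mpr (le_of_lt hts))

/-- A family of increasing maps, moving upwards with the parameter and sending a fixed interval
strictly inside itself, has an attracting fixed point for almost every parameter. -/
lemma ae_exists_fixed_point_deriv_lt_one {H : ℝ → ℝ → ℝ} {J : Set ℝ} {α β : ℝ} (hJ : IsOpen J)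
    (hαβ : α ≤ β) (hdiff : ∀ t, Differentiable ℝ (H t))
    (hH : ∀ t t' x, t ≤ t' → H t x + (t' - t) ≤ H t' x)
    (hα : ∀ t ∈ J, α < H t α) (hβ : ∀ t ∈ J, H t β < β) :
    ∀ᵐ t, t ∈ J → ∃ x ∈ Ioo α β, H t x = x ∧ deriv (H t) x < 1 := by
  set S : ℝ → Set ℝ := fun t => {x | x ∈ Icc α β ∧ H t x ≤ x} with hS
  set f : ℝ → ℝ := fun t => sInf (S t) with hf
  have hbdd : ∀ t, BddBelow (S t) := fun t => ⟨α, fun x hx => hx.1.1⟩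
  have hmemβ : ∀ t ∈ J, β ∈ S t := fun t ht => ⟨right_mem_Icc.mpr hαβ, (hβ t ht).le⟩
  have hcl : ∀ t, IsClosed (S t) := fun t =>
    isClosed_Icc.inter (isClosed_le (hdiff t).continuous continuous_id)
  have hmem : ∀ t ∈ J, f t ∈ S t := fun t ht =>
    (hcl t).csInf_mem ⟨β, hmemβ t ht⟩ (hbdd t)
  have hgt : ∀ t ∈ J, α < f t := fun t ht => by
    refine lt_of_le_of_ne (hmem t ht).1.1 fun h => ?_
    have := (hmem t ht).2
    rw [← h] at this
    exact (hα t ht).not_ge this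
  have hfix : ∀ t ∈ J, H t (f t) = f t := fun t ht => by
    refine le_antisymm (hmem t ht).2 (not_lt.mp fun hlt => ?_)
    have h1 : ∀ᶠ x in 𝓝 (f t), H t x < x :=
      (hdiff t).continuous.continuousAt.eventually_lt continuousAt_id hlt
    have h2 : ∀ᶠ x in 𝓝[<] (f t), (H t x < x ∧ α < x) ∧ x < f t :=
      ((h1.and (lt_mem_nhds (hgt t ht))).filter_mono nhdsWithin_le_nhds).and self_mem_nhdsWithin
    obtain ⟨x, ⟨hx1, hx2⟩, hx3⟩ := h2.exists
    exact hx3.not_ge (csInf_le (hbdd t) ⟨⟨hx2.le, hx3.le.trans (hmem t ht).1.2⟩, hx1.le⟩)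
  have hlt : ∀ t ∈ J, f t < β := fun t ht => by
    refine lt_of_le_of_ne (hmem t ht).1.2 fun h => ?_
    have := hfix t ht
    rw [h] at this
    exact (hβ t ht).ne this
  have hmono : MonotoneOn f J := fun t ht t' ht' htt => by
    refine csInf_le_csInf (hbdd t) ⟨β, hmemβ t' ht'⟩ fun x hx => ⟨hx.1, ?_⟩
    have := hH t t' x htt
    linarith [hx.2]
  filter_upwards [hmono.ae_differentiableWithinAt_of_mem] with t hdt ht
  refine ⟨f t, ⟨hgt t ht, hlt t ht⟩, hfix t ht, ?_⟩
  have hft := ((hdt ht).differentiableAt (hJ.mem_nhds ht)).hasDerivAt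
  have hev : ∀ᶠ s in 𝓝[>] t, s ∈ J ∧ t < s :=
    (show ∀ᶠ s in 𝓝[>] t, s ∈ J from mem_nhdsWithin_of_mem_nhds (hJ.mem_nhds ht)).and
      self_mem_nhdsWithin
  have hv : 0 ≤ deriv f t := nonneg_of_hasDerivAt_of_le_right hft
    (hev.mono fun s hs => hmono ht hs.1 hs.2.le)
  have hg := (hft.sub ((hdiff t (f t)).hasDerivAt.comp t hft)).sub (hasDerivAt_id t)
  have hg0 := nonneg_of_hasDerivAt_of_le_right hg (hev.mono fun s hs => by
    have h1 := hH t s (f s) hs.2.le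
    have h2 := hfix t ht
    have h3 := hfix s hs.1
    simp only [Pi.sub_apply, comp_apply, id]
    linarith)
  nlinarith

/-- The lift to `ℝ` of a set of the circle which is forward invariant under the noisy Arnol'd
map, except possibly for the extreme noises. -/
structure IsArnoldTrap (τ ε σ : ℝ) (K : Set ℝ) : Prop where
  nonempty : K.Nonempty
  add_int_mem : ∀ x ∈ K, ∀ k : ℤ, x + k ∈ K
  mem_of_abs_lt : ∀ x ∈ K, ∀ t, |t| < σ / 2 → arnoldR τ ε x + t ∈ K

lemma IsArnoldTrap.iterate_mem {τ ε σ : ℝ} {K : Set ℝ} (hK : IsArnoldTrap τ ε σ K) {t : ℝ}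
    (ht : |t - τ| < σ / 2) {x : ℝ} (hx : x ∈ K) (n : ℕ) : (arnoldR t ε)^[n] x ∈ K := by
  induction n with
  | zero => exact hx
  | succ n ih =>
    rw [iterate_succ_apply']
    convert hK.mem_of_abs_lt _ ih _ ht using 1
    unfold arnoldR; ring

lemma IsArnoldTrap.exists_recurrent {τ ε σ : ℝ} {K : Set ℝ} (hK : IsArnoldTrap τ ε σ K)
    (hσ : 0 < σ) : ∃ y ∈ K, Ioo (y - σ / 2) (y + σ / 2) ⊆ K ∧
      ∃ (q : ℕ) (l : ℤ), 0 < q ∧ |(arnoldR τ ε)^[q] y - l - y| < σ / 2 := by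
  obtain ⟨x, hx⟩ := hK.nonempty
  set u : ℕ → ℝ := fun n => (arnoldR τ ε)^[n + 1] x with hu
  obtain ⟨a, -, φ, hφ, hlim⟩ := isCompact_Icc.tendsto_subseq
    (x := fun n => Int.fract (u n)) (s := Icc (0 : ℝ) 1)
    fun n => ⟨Int.fract_nonneg _, (Int.fract_lt_one _).le⟩
  obtain ⟨N, hN⟩ := Metric.cauchySeq_iff.mp hlim.cauchySeq (σ / 2) (half_pos hσ)
  have hlt : φ N < φ (N + 1) := hφ N.lt_succ_self
  have h0 : |τ - τ| < σ / 2 := by simpa using half_pos hσ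
  refine ⟨u (φ N), hK.iterate_mem h0 hx _, fun z hz => ?_, φ (N + 1) - φ N,
    ⌊u (φ (N + 1))⌋ - ⌊u (φ N)⌋, Nat.sub_pos_of_lt hlt, ?_⟩
  · have := hK.mem_of_abs_lt _ (hK.iterate_mem h0 hx (φ N)) (z - u (φ N))
      (abs_sub_lt_iff.mpr ⟨by linarith [hz.2], by linarith [hz.1]⟩)
    convert this using 1
    simp only [hu, iterate_succ_apply']
    ring
  · have h1 := hN (N + 1) (by simp) N le_rfl
    have h2 : (arnoldR τ ε)^[φ (N + 1) - φ N] (u (φ N)) = u (φ (N + 1)) := by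
      simp only [hu]
      rw [← iterate_add_apply,
        show φ (N + 1) - φ N + (φ N + 1) = φ (N + 1) + 1 by omega]
    rw [h2]
    rw [Real.dist_eq, comp_apply, comp_apply, Int.fract, Int.fract] at h1
    convert h1 using 2
    push_cast; ring

lemma IsArnoldTrap.ae_exists_attracting {τ ε σ : ℝ} (hε : 0 < ε) (hε1 : 2 * π * ε < 1)
    (hσ : 0 < σ) {K : Set ℝ} (hK : IsArnoldTrap τ ε σ K) (hne : K ≠ univ) :
    ∀ᵐ t, |t - τ| < σ / 2 → ∃ p ∈ K, ∃ (q : ℕ) (l : ℤ), 0 < q ∧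
      (arnoldR t ε)^[q] p = p + l ∧ deriv (arnoldR t ε)^[q] p < 1 := by
  obtain ⟨y, hy, hyK, q, l, hq, hrec⟩ := hK.exists_recurrent hσ
  set J : Set ℝ := Metric.ball τ (σ / 2) with hJ
  set H : ℝ → ℝ → ℝ := fun t x => (arnoldR t ε)^[q] x - l with hH
  set C : Set ℝ := connectedComponentIn K y with hC
  have hyC : y ∈ C := mem_connectedComponentIn hy
  have hCK : C ⊆ K := connectedComponentIn_subset K y
  have hCpre : IsPreconnected C := isPreconnected_connectedComponentIn
  have hCord : OrdConnected C := hCpre.ordConnected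
  have hτJ : τ ∈ J := Metric.mem_ball_self (half_pos hσ)
  have hHy : H τ y ∈ C := by
    refine isPreconnected_Ioo.subset_connectedComponentIn
      (⟨by linarith, by linarith⟩ : y ∈ Ioo (y - σ / 2) (y + σ / 2)) hyK ?_
    have := abs_sub_lt_iff.mp hrec
    exact ⟨by linarith [this.2], by linarith [this.1]⟩
  have hHcont : Continuous fun p : ℝ × ℝ => H p.1 p.2 :=
    (continuous_iterate_arnoldR ε q).sub continuous_const
  have hHC : ∀ t ∈ J, ∀ x ∈ C, H t x ∈ C := by
    have hpre : IsPreconnected ((fun p : ℝ × ℝ => H p.1 p.2) '' (J ×ˢ C)) :=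
      ((convex_ball τ (σ / 2)).isPreconnected.prod hCpre).image _ hHcont.continuousOn
    have hsub : (fun p : ℝ × ℝ => H p.1 p.2) '' (J ×ˢ C) ⊆ K := by
      rintro _ ⟨⟨t, x⟩, ⟨ht, hx⟩, rfl⟩
      have := hK.add_int_mem _
        (hK.iterate_mem (by rwa [← Real.dist_eq, ← Metric.mem_ball]) (hCK hx) q) (-l)
      simpa [hH, sub_eq_add_neg] using this
    have := hpre.subset_connectedComponentIn ⟨(τ, y), ⟨hτJ, hyC⟩, rfl⟩ hsub
    rw [← connectedComponentIn_eq hHy] at this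
    exact fun t ht x hx => this ⟨(t, x), ⟨ht, hx⟩, rfl⟩
  obtain ⟨z, hz⟩ := (ne_univ_iff_exists_notMem K).mp hne
  have hzK : ∀ k : ℤ, z + k ∉ K := fun k hk => hz (by simpa using hK.add_int_mem _ hk (-k))
  have hba : BddAbove C := by
    refine ⟨z + ⌈y - z⌉, fun c hc => not_lt.mp fun hlt =>
      hzK _ (hCK (hCord.out hyC hc ⟨?_, hlt.le⟩))⟩
    linarith [Int.le_ceil (y - z)]
  have hbb : BddBelow C := by
    refine ⟨z + ⌊y - z⌋, fun c hc => not_lt.mp fun hlt =>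
      hzK _ (hCK (hCord.out hc hyC ⟨hlt.le, ?_⟩))⟩
    linarith [Int.floor_le (y - z)]
  have hHle : ∀ t t' x, t ≤ t' → H t x + (t' - t) ≤ H t' x := fun t t' x ht => by
    have := iterate_arnoldR_add_le hε hε1 ht hq x
    simp only [hH]; linarith
  have hdiff : ∀ t, Differentiable ℝ (H t) := fun t =>
    ((differentiable_arnoldR t ε).iterate q).sub_const _
  have hαle : ∀ t ∈ J, sInf C ≤ H t (sInf C) := fun t ht =>
    closure_minimal (t := {x | sInf C ≤ H t x}) (fun x hx => csInf_le hbb (hHC t ht x hx))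
      (isClosed_le continuous_const (hdiff t).continuous) (csInf_mem_closure ⟨y, hyC⟩ hbb)
  have hβle : ∀ t ∈ J, H t (sSup C) ≤ sSup C := fun t ht =>
    closure_minimal (t := {x | H t x ≤ sSup C}) (fun x hx => le_csSup hba (hHC t ht x hx))
      (isClosed_le (hdiff t).continuous continuous_const) (csSup_mem_closure ⟨y, hyC⟩ hba)
  have hJopen : IsOpen J := Metric.isOpen_ball
  have hmain := ae_exists_fixed_point_deriv_lt_one hJopen (csInf_le_csSup ⟨y, hyC⟩ hbb hba)
    hdiff hHle
    (fun t ht => by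
      obtain ⟨t', ht', htt⟩ := ((show ∀ᶠ s in 𝓝[<] t, s ∈ J from
        mem_nhdsWithin_of_mem_nhds (hJopen.mem_nhds ht)).and self_mem_nhdsWithin).exists
      have htt : t' < t := htt
      linarith [hαle t' ht', hHle t' t (sInf C) htt.le])
    (fun t ht => by
      obtain ⟨t', ht', htt⟩ := ((show ∀ᶠ s in 𝓝[>] t, s ∈ J from
        mem_nhdsWithin_of_mem_nhds (hJopen.mem_nhds ht)).and self_mem_nhdsWithin).exists
      have htt : t < t' := htt
      linarith [hβle t' ht', hHle t t' (sSup C) htt.le])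
  filter_upwards [hmain] with t ht htτ
  obtain ⟨p, hp, hfix, hder⟩ := ht (by rwa [hJ, Metric.mem_ball, Real.dist_eq])
  obtain ⟨c, hc, hcp⟩ := exists_lt_of_csInf_lt ⟨y, hyC⟩ hp.1
  obtain ⟨c', hc', hcp'⟩ := exists_lt_of_lt_csSup ⟨y, hyC⟩ hp.2
  refine ⟨p, hCK (hCord.out hc hc' ⟨hcp.le, hcp'.le⟩), q, l, hq, ?_, ?_⟩
  · simp only [hH] at hfix; linarith
  · simpa only [hH, deriv_sub_const] using hder

lemma IsArnoldTrap.inter_nonempty {τ ε σ : ℝ} (hε : 0 < ε) (hε1 : 2 * π * ε < 1) (hσ : 0 < σ)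
    {K₁ K₂ : Set ℝ} (h₁ : IsArnoldTrap τ ε σ K₁) (h₂ : IsArnoldTrap τ ε σ K₂) :
    (K₁ ∩ K₂).Nonempty := by
  by_contra hcon
  rw [not_nonempty_iff_eq_empty, ← disjoint_iff_inter_eq_empty] at hcon
  have hne₁ : K₁ ≠ univ := fun h => by
    obtain ⟨x, hx⟩ := h₂.nonempty
    exact hcon.notMem_of_mem_right hx (h ▸ mem_univ x)
  have hne₂ : K₂ ≠ univ := fun h => by
    obtain ⟨x, hx⟩ := h₁.nonempty
    exact hcon.notMem_of_mem_left hx (h ▸ mem_univ x)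
  have hae := (h₁.ae_exists_attracting hε hε1 hσ hne₁).and
    (h₂.ae_exists_attracting hε hε1 hσ hne₂)
  obtain ⟨t, ht, hat₁, hat₂⟩ : ∃ t, |t - τ| < σ / 2 ∧ _ ∧ _ := by
    have hfr : ∃ᵐ t : ℝ, t ∈ Metric.ball τ (σ / 2) :=
      frequently_ae_mem_iff.mpr (Metric.measure_ball_pos volume τ (half_pos hσ)).ne'
    obtain ⟨t, ht, ht'⟩ := (hfr.and_eventually hae).exists
    exact ⟨t, by rwa [Metric.mem_ball, Real.dist_eq] at ht, ht'⟩
  obtain ⟨p₁, hp₁, q₁, l₁, hq₁, hf₁, hd₁⟩ := hat₁ ht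
  obtain ⟨p₂, hp₂, q₂, l₂, hq₂, hf₂, hd₂⟩ := hat₂ ht
  obtain ⟨d, l, h⟩ := exists_iterate_eq_of_attracting (τ := t) hε hε1 hq₁ hq₂
    (p₁ := p₁) (p₂ := p₂) (l₁ := l₁) (l₂ := l₂)
    (by rw [iterate_arnoldC_ofReal, hf₁]; push_cast; rfl)
    (by rwa [norm_deriv_iterate_arnoldC_ofReal hε hε1])
    (by rw [iterate_arnoldC_ofReal, hf₂]; push_cast; rfl)
    (by rwa [norm_deriv_iterate_arnoldC_ofReal hε hε1])
  rw [iterate_arnoldC_ofReal, iterate_arnoldC_ofReal] at h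
  rcases h with h | h
  · have h' : (arnoldR t ε)^[d] p₁ = p₂ + l := by exact_mod_cast h
    have := h₁.iterate_mem ht hp₁ d
    rw [h'] at this
    exact hcon.notMem_of_mem_left this (h₂.add_int_mem _ hp₂ l)
  · have h' : (arnoldR t ε)^[d] p₂ = p₁ + l := by exact_mod_cast h
    have := h₂.iterate_mem ht hp₂ d
    rw [h'] at this
    exact hcon.notMem_of_mem_left (h₁.add_int_mem _ hp₁ l) this

lemma sinA_coe (x : ℝ) : sinA (x : AddCircle (1 : ℝ)) = Real.sin (2 * π * x) :=
  sin2_periodic.lift_coe x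

lemma continuous_sinA : Continuous sinA := by
  refine (QuotientAddGroup.isQuotientMap_mk
    (N := AddSubgroup.zmultiples (1 : ℝ))).continuous_iff.mpr ?_
  have : sinA ∘ (QuotientAddGroup.mk : ℝ → AddCircle (1 : ℝ)) = fun x => Real.sin (2 * π * x) :=
    funext sinA_coe
  rw [this]
  fun_prop

lemma Fmap_coe (τ ε σ w x : ℝ) :
    Fmap τ ε σ w (x : AddCircle (1 : ℝ)) = ((arnoldR τ ε x + σ * w : ℝ) : AddCircle (1 : ℝ)) := by
  rw [Fmap, sinA_coe, ← AddCircle.coe_add, arnoldR]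
  congr 1
  ring

lemma continuous_uncurry_Fmap (τ ε σ : ℝ) : Continuous (uncurry (Fmap τ ε σ)) := by
  have h := continuous_sinA
  exact continuous_snd.add ((AddCircle.continuous_mk' (1 : ℝ)).comp (by fun_prop))

instance : IsProbabilityMeasure nuI := ⟨by norm_num [nuI]⟩

/-- The action of the noisy Arnol'd map on measures. -/
def transfer (τ ε σ : ℝ) (m : Measure (AddCircle (1 : ℝ))) : Measure (AddCircle (1 : ℝ)) :=
  (nuI.prod m).map (uncurry (Fmap τ ε σ))

lemma transfer_apply (τ ε σ : ℝ) (m : Measure (AddCircle (1 : ℝ))) [SFinite m]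
    {s : Set (AddCircle (1 : ℝ))} (hs : MeasurableSet s) :
    transfer τ ε σ m s = ∫⁻ x, nuI {w | Fmap τ ε σ w x ∈ s} ∂m := by
  have hF := (continuous_uncurry_Fmap τ ε σ).measurable
  rw [transfer, Measure.map_apply hF hs, Measure.prod_apply_symm (hF hs)]
  rfl

lemma isStationaryMeasure_iff (τ ε σ : ℝ) (m : Measure (AddCircle (1 : ℝ))) [SFinite m] :
    IsStationaryMeasure τ ε σ m ↔ transfer τ ε σ m = m := by
  have hF := (continuous_uncurry_Fmap τ ε σ).measurable
  have hw : ∀ w, Measurable (Fmap τ ε σ w) := fun w => hF.comp measurable_prodMk_left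
  suffices h : nuI.bind (fun w => m.map (Fmap τ ε σ w)) = transfer τ ε σ m by
    rw [IsStationaryMeasure, h]
  have hmeas : Measurable fun w => m.map (Fmap τ ε σ w) := by
    refine Measure.measurable_of_measurable_coe _ fun s hs => ?_
    simp_rw [Measure.map_apply (hw _) hs]
    exact measurable_measure_prodMk_left (hF hs)
  ext s hs
  rw [Measure.bind_apply hs hmeas.aemeasurable, transfer, Measure.map_apply hF hs,
    Measure.prod_apply (hF hs)]
  simp_rw [Measure.map_apply (hw _) hs]
  rfl

instance (τ ε σ : ℝ) (m : Measure (AddCircle (1 : ℝ))) [IsProbabilityMeasure m] :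
    IsProbabilityMeasure (transfer τ ε σ m) :=
  Measure.isProbabilityMeasure_map (continuous_uncurry_Fmap τ ε σ).aemeasurable

/-- The positive part of the difference of two stationary measures is stationary. -/
lemma transfer_sub {τ ε σ : ℝ} {m₁ m₂ : Measure (AddCircle (1 : ℝ))} [IsFiniteMeasure m₁]
    [IsFiniteMeasure m₂] (h₁ : transfer τ ε σ m₁ = m₁) (h₂ : transfer τ ε σ m₂ = m₂) :
    transfer τ ε σ (m₁ - m₂) = m₁ - m₂ := by
  have hle : m₁ ≤ (m₁ - m₂) + m₂ := Measure.sub_le_iff_le_add.mp le_rfl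
  refine (Measure.eq_of_le_of_measure_univ_eq (Measure.sub_le_of_le_add ?_) ?_).symm
  · refine Measure.le_iff.mpr fun s hs => ?_
    calc m₁ s = transfer τ ε σ m₁ s := by rw [h₁]
      _ = ∫⁻ x, nuI {w | Fmap τ ε σ w x ∈ s} ∂m₁ := transfer_apply τ ε σ m₁ hs
      _ ≤ ∫⁻ x, nuI {w | Fmap τ ε σ w x ∈ s} ∂((m₁ - m₂) + m₂) := lintegral_mono' hle le_rfl
      _ = transfer τ ε σ (m₁ - m₂) s + transfer τ ε σ m₂ s := by
        rw [lintegral_add_measure, transfer_apply τ ε σ _ hs, transfer_apply τ ε σ _ hs]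
      _ = (transfer τ ε σ (m₁ - m₂) + m₂) s := by rw [h₂, Measure.add_apply]
  · rw [transfer_apply _ _ _ _ MeasurableSet.univ]
    simp

/-- Near the image of a point of its support, a stationary measure dominates a multiple of the
Lebesgue measure. -/
lemma exists_smul_volume_le_of_mem_support {τ ε σ : ℝ} (hσ : 0 < σ)
    {d : Measure (AddCircle (1 : ℝ))} [SFinite d] (hd : transfer τ ε σ d = d) {x t : ℝ}
    (hx : (x : AddCircle (1 : ℝ)) ∈ d.support) (ht : |t| < σ / 2) :
    ∃ δ > 0, ∃ c ≠ 0, ∀ s : Set (AddCircle (1 : ℝ)), MeasurableSet s →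
      c * volume (Metric.ball (arnoldR τ ε x + t) δ ∩ (↑) ⁻¹' s) ≤ d s := by
  set δ := (σ / 2 - |t|) / 3 with hδ
  have hδ0 : 0 < δ := by rw [hδ]; linarith
  have hcont := (differentiable_arnoldR τ ε).continuous
  set V : Set ℝ := arnoldR τ ε ⁻¹' Metric.ball (arnoldR τ ε x) δ with hV
  have hVo : IsOpen V := Metric.isOpen_ball.preimage hcont
  set U : Set (AddCircle (1 : ℝ)) := (↑) '' V with hU
  have hUo : IsOpen U := QuotientAddGroup.isOpenMap_coe V hVo
  have hdU : 0 < d U := Measure.mem_support_iff_forall _ |>.mp hx U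
    (hUo.mem_nhds ⟨x, Metric.mem_ball_self hδ0, rfl⟩)
  refine ⟨δ, hδ0, d U * ENNReal.ofReal |σ⁻¹|, mul_ne_zero hdU.ne' ?_, fun s hs => ?_⟩
  · simpa using hσ.ne'
  set E : Set ℝ := Metric.ball (arnoldR τ ε x + t) δ ∩ (↑) ⁻¹' s with hE
  have key : ∀ u ∈ U, ENNReal.ofReal |σ⁻¹| * volume E ≤ nuI {w | Fmap τ ε σ w u ∈ s} := by
    rintro _ ⟨v, hv, rfl⟩
    have h1 : (fun w => arnoldR τ ε v + σ * w) ⁻¹' E ⊆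
        {w | Fmap τ ε σ w (v : AddCircle (1 : ℝ)) ∈ s} ∩ Icc (-(1 / 2)) (1 / 2) := by
      rintro w ⟨hw1, hw2⟩
      refine ⟨by rw [mem_ofPred_eq, Fmap_coe]; exact hw2, ?_⟩
      rw [Metric.mem_ball, Real.dist_eq] at hw1
      have hv' : |arnoldR τ ε v - arnoldR τ ε x| < δ := hv
      have h3 := abs_lt.mp hw1
      have h4 := abs_lt.mp hv'
      have h5 := abs_le.mp (le_refl |t|)
      constructor <;> nlinarith
    have h2 : volume ((fun w => arnoldR τ ε v + σ * w) ⁻¹' E) =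
        ENNReal.ofReal |σ⁻¹| * volume E := by
      have : (fun w => arnoldR τ ε v + σ * w) ⁻¹' E =
          (σ * ·) ⁻¹' ((arnoldR τ ε v + ·) ⁻¹' E) := rfl
      rw [this, Real.volume_preimage_mul_left hσ.ne', measure_preimage_add]
    rw [← h2]
    exact (measure_mono h1).trans (Measure.le_restrict_apply _ _)
  calc d U * ENNReal.ofReal |σ⁻¹| * volume E
      = ∫⁻ _ in U, ENNReal.ofReal |σ⁻¹| * volume E ∂d := by
        rw [setLIntegral_const, mul_comm _ (d U), mul_assoc]
    _ ≤ ∫⁻ u in U, nuI {w | Fmap τ ε σ w u ∈ s} ∂d := setLIntegral_mono' hUo.measurableSet key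
    _ ≤ ∫⁻ u, nuI {w | Fmap τ ε σ w u ∈ s} ∂d := setLIntegral_le_lintegral _ _
    _ = d s := by rw [← transfer_apply τ ε σ d hs, hd]

lemma isArnoldTrap_support {τ ε σ : ℝ} (hσ : 0 < σ) {d : Measure (AddCircle (1 : ℝ))} [SFinite d]
    (hd : transfer τ ε σ d = d) (hd0 : d ≠ 0) :
    IsArnoldTrap τ ε σ ((↑) ⁻¹' d.support) where
  nonempty := by
    obtain ⟨x, hx⟩ := Measure.nonempty_support hd0
    obtain ⟨x, rfl⟩ := QuotientAddGroup.mk_surjective x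
    exact ⟨x, hx⟩
  add_int_mem x hx k := by
    have : ((x + k : ℝ) : AddCircle (1 : ℝ)) = x := by
      rw [AddCircle.coe_add,
        (AddCircle.coe_eq_zero_iff 1 (x := (k : ℝ))).mpr ⟨k, by simp⟩, add_zero]
    rwa [mem_preimage, this]
  mem_of_abs_lt x hx t ht := by
    obtain ⟨δ, hδ, c, hc, h⟩ := exists_smul_volume_le_of_mem_support hσ hd hx ht
    rw [mem_preimage, Measure.mem_support_iff_forall]
    intro N hN
    obtain ⟨s, hsN, hs, hys⟩ := mem_nhds_iff.mp hN
    refine lt_of_lt_of_le (lt_of_lt_of_le ?_ (h s hs.measurableSet)) (measure_mono hsN)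
    have hopen : IsOpen (Metric.ball (arnoldR τ ε x + t) δ ∩ (↑) ⁻¹' s) :=
      Metric.isOpen_ball.inter (hs.preimage (AddCircle.continuous_mk' 1))
    exact ENNReal.mul_pos hc (hopen.measure_pos _ ⟨_, Metric.mem_ball_self hδ, hys⟩).ne'

lemma eq_of_transfer_eq {τ ε σ : ℝ} (hε : 0 < ε) (hε1 : 2 * π * ε < 1) (hσ : 0 < σ)
    {m₁ m₂ : Measure (AddCircle (1 : ℝ))} [IsProbabilityMeasure m₁] [IsProbabilityMeasure m₂]
    (h₁ : transfer τ ε σ m₁ = m₁) (h₂ : transfer τ ε σ m₂ = m₂) : m₁ = m₂ := by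
  by_contra hne
  have hd₁ : m₁ - m₂ ≠ 0 := fun h => hne <| Measure.eq_of_le_of_isProbabilityMeasure <| by
    simpa using Measure.sub_le_iff_le_add.mp h.le
  have hd₂ : m₂ - m₁ ≠ 0 := fun h => hne <| Eq.symm <|
    Measure.eq_of_le_of_isProbabilityMeasure <| by
      simpa using Measure.sub_le_iff_le_add.mp h.le
  have hP₁ := transfer_sub h₁ h₂
  have hP₂ := transfer_sub h₂ h₁
  obtain ⟨x, hx₁, hx₂⟩ := (isArnoldTrap_support hσ hP₁ hd₁).inter_nonempty hε hε1 hσ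
    (isArnoldTrap_support hσ hP₂ hd₂)
  obtain ⟨s, hs, hs₁, hs₂⟩ := Measure.mutually_singular_measure_sub (μ := m₁) (ν := m₂)
  have h0 : |(0 : ℝ)| < σ / 2 := by simpa using hσ
  obtain ⟨δ₁, hδ₁, c₁, hc₁, hb₁⟩ := exists_smul_volume_le_of_mem_support hσ hP₁ hx₁ h0
  obtain ⟨δ₂, hδ₂, c₂, hc₂, hb₂⟩ := exists_smul_volume_le_of_mem_support hσ hP₂ hx₂ h0
  set y := arnoldR τ ε x + 0
  have hz₁ : volume (Metric.ball y δ₁ ∩ (↑) ⁻¹' s) = 0 := by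
    simpa [hs₁, hc₁] using hb₁ s hs
  have hz₂ : volume (Metric.ball y δ₂ ∩ (↑) ⁻¹' sᶜ) = 0 := by
    simpa [hs₂, hc₂] using hb₂ sᶜ hs.compl
  refine (Metric.measure_ball_pos volume y (lt_min hδ₁ hδ₂)).ne'
    (measure_mono_null (fun z hz => ?_) (measure_union_null hz₁ hz₂))
  by_cases hzs : (z : AddCircle (1 : ℝ)) ∈ s
  · exact Or.inl ⟨Metric.ball_subset_ball (min_le_left _ _) hz, hzs⟩
  · exact Or.inr ⟨Metric.ball_subset_ball (min_le_right _ _) hz, hzs⟩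

open scoped BoundedContinuousFunction in
/-- The expected value of an observable after one step of the noisy Arnol'd map. -/
def koopman (τ ε σ : ℝ) (f : AddCircle (1 : ℝ) →ᵇ ℝ) : AddCircle (1 : ℝ) →ᵇ ℝ :=
  .mkOfCompact ⟨fun x => ∫ w, f (Fmap τ ε σ w x) ∂nuI, by
    refine continuous_parametric_integral_of_continuous (μ := volume)
      (f := fun x w => f (Fmap τ ε σ w x)) ?_ isCompact_Icc
    exact f.continuous.comp ((continuous_uncurry_Fmap τ ε σ).comp continuous_swap)⟩

open scoped BoundedContinuousFunction in
lemma integral_transfer (τ ε σ : ℝ) (m : Measure (AddCircle (1 : ℝ))) [IsProbabilityMeasure m]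
    (f : AddCircle (1 : ℝ) →ᵇ ℝ) :
    ∫ x, f x ∂(transfer τ ε σ m) = ∫ x, koopman τ ε σ f x ∂m := by
  have hF := continuous_uncurry_Fmap τ ε σ
  rw [transfer, integral_map hF.aemeasurable f.continuous.aestronglyMeasurable,
    integral_prod_symm]
  · rfl
  · exact (f.integrable (transfer τ ε σ m)).comp_measurable hF.measurable

/-- The orbit of a point mass under the noisy Arnol'd map. -/
def transferOrbit (τ ε σ : ℝ) : ℕ → ProbabilityMeasure (AddCircle (1 : ℝ))
  | 0 => ⟨Measure.dirac 0, inferInstance⟩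
  | n + 1 => ⟨transfer τ ε σ (transferOrbit τ ε σ n), inferInstance⟩

/-- The time averages of `transferOrbit`. -/
def transferAverage (τ ε σ : ℝ) (n : ℕ) : ProbabilityMeasure (AddCircle (1 : ℝ)) :=
  ⟨((n : ENNReal) + 1)⁻¹ • ∑ i ∈ Finset.range (n + 1),
    (transferOrbit τ ε σ i : Measure (AddCircle (1 : ℝ))), ⟨by
      rw [Measure.smul_apply, Measure.finsetSum_apply]
      simp only [measure_univ, Finset.sum_const, Finset.card_range, smul_eq_mul, nsmul_eq_mul,
        mul_one, Nat.cast_add, Nat.cast_one]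
      exact ENNReal.inv_mul_cancel (by simp) (by finiteness)⟩⟩

open scoped BoundedContinuousFunction in
lemma integral_transferAverage (τ ε σ : ℝ) (n : ℕ) (f : AddCircle (1 : ℝ) →ᵇ ℝ) :
    ∫ x, f x ∂(transferAverage τ ε σ n : Measure (AddCircle (1 : ℝ))) =
      ((n : ℝ) + 1)⁻¹ * ∑ i ∈ Finset.range (n + 1),
        ∫ x, f x ∂(transferOrbit τ ε σ i : Measure (AddCircle (1 : ℝ))) := by
  change ∫ x, f x ∂(((n : ENNReal) + 1)⁻¹ • ∑ i ∈ Finset.range (n + 1),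
    (transferOrbit τ ε σ i : Measure (AddCircle (1 : ℝ)))) = _
  rw [integral_smul_measure, integral_finsetSum_measure fun i _ => f.integrable _,
    ENNReal.toReal_inv, ENNReal.toReal_add (by finiteness) (by finiteness)]
  simp

open scoped BoundedContinuousFunction in
lemma tendsto_integral_koopman_sub (τ ε σ : ℝ) (f : AddCircle (1 : ℝ) →ᵇ ℝ) :
    Tendsto (fun n => ∫ x, koopman τ ε σ f x ∂(transferAverage τ ε σ n : Measure _) -
      ∫ x, f x ∂(transferAverage τ ε σ n : Measure _)) atTop (𝓝 0) := by
  set a : ℕ → ℝ := fun i => ∫ x, f x ∂(transferOrbit τ ε σ i : Measure (AddCircle (1 : ℝ)))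
    with ha
  have hbound : ∀ i, |a i| ≤ ‖f‖ := fun i => by
    simpa using f.norm_integral_le_norm (transferOrbit τ ε σ i : Measure (AddCircle (1 : ℝ)))
  have hstep : ∀ i, ∫ x, koopman τ ε σ f x ∂(transferOrbit τ ε σ i : Measure _) = a (i + 1) :=
    fun i => (integral_transfer τ ε σ _ f).symm
  have hlim : Tendsto (fun n : ℕ => 1 / ((n : ℝ) + 1) * (2 * ‖f‖)) atTop (𝓝 0) := by
    simpa using tendsto_one_div_add_atTop_nhds_zero_nat.mul_const (2 * ‖f‖)
  refine squeeze_zero_norm (fun n => ?_) hlim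
  rw [integral_transferAverage, integral_transferAverage, ← mul_sub, ← Finset.sum_sub_distrib]
  simp_rw [hstep]
  rw [Finset.sum_range_sub a, norm_mul, Real.norm_eq_abs, Real.norm_eq_abs, one_div,
    abs_of_pos (by positivity : 0 < ((n : ℝ) + 1)⁻¹)]
  gcongr
  have := abs_sub (a (n + 1)) (a 0)
  linarith [hbound (n + 1), hbound 0]

lemma exists_transfer_eq (τ ε σ : ℝ) :
    ∃ m : Measure (AddCircle (1 : ℝ)), IsProbabilityMeasure m ∧ transfer τ ε σ m = m := by
  obtain ⟨μ, hμ⟩ : ∃ μ, Tendsto (transferAverage τ ε σ) (hyperfilter ℕ) (𝓝 μ) :=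
    ⟨_, ((hyperfilter ℕ).map (transferAverage τ ε σ)).le_nhds_lim⟩
  rw [ProbabilityMeasure.tendsto_iff_forall_integral_tendsto] at hμ
  refine ⟨μ, inferInstance, ext_of_forall_integral_eq_of_IsFiniteMeasure fun f => ?_⟩
  rw [integral_transfer, ← sub_eq_zero]
  exact tendsto_nhds_unique ((hμ (koopman τ ε σ f)).sub (hμ f))
    ((tendsto_integral_koopman_sub τ ε σ f).mono_left Nat.hyperfilter_le_atTop)

/-- **Existence and uniqueness of the stationary measure** for the noisy Arnol'd
circle-map family: a stationary Borel probability measure exists, and any two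
stationary Borel probability measures coincide. -/
theorem noisy_circle_map_stationary_measure (τ ε σ : ℝ)
    (hε : 0 < ε) (hεπ : 2 * π * ε < 1) (hσ : 0 < σ) :
    (∃ m : Measure (AddCircle (1:ℝ)), IsProbabilityMeasure m ∧ IsStationaryMeasure τ ε σ m) ∧
      ∀ m₁ m₂ : Measure (AddCircle (1:ℝ)),
        IsProbabilityMeasure m₁ → IsStationaryMeasure τ ε σ m₁ →
        IsProbabilityMeasure m₂ → IsStationaryMeasure τ ε σ m₂ → m₁ = m₂ := by
  refine ⟨?_, fun m₁ m₂ _ h₁ _ h₂ => ?_⟩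
  · obtain ⟨m, hm, h⟩ := exists_transfer_eq τ ε σ
    exact ⟨m, hm, (isStationaryMeasure_iff τ ε σ m).mpr h⟩
  · rw [isStationaryMeasure_iff] at h₁ h₂
    exact eq_of_transfer_eq hε hεπ hσ h₁ h₂
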